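/- arXiv:2005.02755 — 2 statements merged into one kernel-verified Lean document; each statement's English description precedes it below -/
import Mathlib

section
/- Let u ∈ H¹(0,1) and let ρ*_{cos,m}(u) = u - û_cos(1) - Σ_{k=2}^{m} û_cos(k) √2 cos((k-1)πx), where û_cos(1) = ∫₀¹ u and û_cos(k) = ∫₀¹ u(x) √2 cos((k-1)πx) dx. Then ‖ρ*_{cos,m}(u)‖_{L²(0,1)} ≤ (1/(πm)) ‖u'‖_{L²(0,1)}. -/
open MeasureTheory

/-- `u` is an `H¹` function on `(0,1)` with weak derivative `u'`. -/
def IsH1 (u u' : ℝ → ℝ) : Prop :=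
  ContinuousOn u (Set.Icc 0 1) ∧
  IntervalIntegrable u' volume 0 1 ∧
  IntervalIntegrable (fun t => u' t ^ 2) volume 0 1 ∧
  ∀ x ∈ Set.Icc (0:ℝ) 1, u x = u 0 + ∫ t in (0:ℝ)..x, u' t

/-- The `L²(0,1)` norm. -/
noncomputable def L2norm (v : ℝ → ℝ) : ℝ :=
  Real.sqrt (∫ x in (0:ℝ)..1, v x ^ 2)

/-- The cosine Fourier coefficient: `û_cos(1) = ∫₀¹ u` and
`û_cos(k) = ∫₀¹ u(x) √2 cos((k-1)πx) dx` for `k ≥ 2`. -/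
noncomputable def cosCoeff (u : ℝ → ℝ) (k : ℕ) : ℝ :=
  if k = 1 then ∫ x in (0:ℝ)..1, u x
  else ∫ x in (0:ℝ)..1, u x * (Real.sqrt 2 * Real.cos (((k:ℝ) - 1) * Real.pi * x))


lemma intervalIntegrable_neg_one_one_of_parity {F : ℝ → ℝ} {s : ℝ}
    (hF : IntervalIntegrable F volume 0 1) (hs : ∀ x, F (-x) = s * F x) :
    IntervalIntegrable F volume (-1) 1 := by
  refine IntervalIntegrable.trans (b := 0) ?_ hF
  rw [← neg_zero, IntervalIntegrable.iff_comp_neg]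
  simp only [neg_neg, neg_zero, hs]
  exact (hF.const_mul s).symm

/-- Parseval's identity on `(-1,1)` for a function with `F (-x) = s * F x`, `s = ±1`. -/
lemma hasSum_sq_fourier_of_parity {F : ℝ → ℝ} {s : ℝ} (hs2 : s ^ 2 = 1)
    (hs : ∀ x, F (-x) = s * F x) (hF : IntervalIntegrable F volume 0 1)
    (hF2 : IntervalIntegrable (fun x => F x ^ 2) volume 0 1) :
    HasSum (fun n : ℤ => ‖∫ x in (0:ℝ)..1, ((Complex.exp (-(n * Real.pi * x * Complex.I))
        + s * Complex.exp (n * Real.pi * x * Complex.I)) / 2) * (F x : ℂ)‖ ^ 2)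
      (∫ x in (0:ℝ)..1, F x ^ 2) := by
  have hG := intervalIntegrable_neg_one_one_of_parity hF hs
  have hG2 : IntervalIntegrable (fun x => F x ^ 2) volume (-1) 1 :=
    intervalIntegrable_neg_one_one_of_parity (s := 1) hF2 fun x => by rw [hs, mul_pow, hs2]
  have h11 : (-1:ℝ) < 1 := by norm_num
  have hmem : MemLp (fun x => (F x : ℂ)) 2 (volume.restrict (Set.Ioc (-1:ℝ) 1)) := by
    refine MemLp.ofReal ((memLp_two_iff_integrable_sq ?_).2 ?_)
    · exact ((intervalIntegrable_iff_integrableOn_Ioc_of_le h11.le).1 hG).aestronglyMeasurable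
    · exact (intervalIntegrable_iff_integrableOn_Ioc_of_le h11.le).1 hG2
  have fold : ∀ {E : Type} [NormedAddCommGroup E] [NormedSpace ℝ E] (G : ℝ → E),
      IntervalIntegrable G volume (-1) 1 →
      ∫ x in (-1:ℝ)..1, G x = ∫ x in (0:ℝ)..1, (G x + G (-x)) := by
    intro E _ _ G hG
    have h1 : IntervalIntegrable G volume (-1) 0 := hG.mono_set (by
      rw [Set.uIcc_of_le, Set.uIcc_of_le] <;> norm_num
      exact Set.Icc_subset_Icc_right (by norm_num))
    have h2 : IntervalIntegrable G volume 0 1 := hG.mono_set (by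
      rw [Set.uIcc_of_le, Set.uIcc_of_le] <;> norm_num
      exact Set.Icc_subset_Icc_left (by norm_num))
    have h3 : IntervalIntegrable (fun x => G (-x)) volume 0 1 := by
      have := (IntervalIntegrable.iff_comp_neg (f := G)).1 h1
      simpa using this.symm
    rw [intervalIntegral.integral_add h2 h3, intervalIntegral.integral_comp_neg,
      ← intervalIntegral.integral_add_adjacent_intervals h1 h2, neg_zero, add_comm]
  convert hasSum_sq_fourierCoeffOn h11 hmem using 1
  · funext n
    rw [fourierCoeffOn_eq_integral, fold, ← intervalIntegral.integral_smul]
    · congr 2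
      refine intervalIntegral.integral_congr fun x _ => ?_
      have e1 : (2 * Real.pi * Complex.I * ((-n : ℤ) : ℂ) * (x : ℂ) / ((1 - -1 : ℝ) : ℂ))
          = -(n * Real.pi * x * Complex.I) := by push_cast; ring
      have e2 : (2 * Real.pi * Complex.I * ((-n : ℤ) : ℂ) * ((-x : ℝ) : ℂ) / ((1 - -1 : ℝ) : ℂ))
          = n * Real.pi * x * Complex.I := by push_cast; ring
      simp only [fourier_coe_apply, e1, e2, hs, smul_eq_mul, Complex.real_smul]
      push_cast
      ring
    · simp only [fourier_coe_apply, smul_eq_mul]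
      refine IntervalIntegrable.continuousOn_mul ?_ (by fun_prop)
      exact ⟨hG.1.ofReal, hG.2.ofReal⟩
  · rw [fold]
    · simp only [Complex.norm_real, Real.norm_eq_abs, sq_abs, hs, mul_pow, hs2, one_mul]
      rw [intervalIntegral.integral_add hF2 hF2, smul_eq_mul]
      ring
    · simpa using hG2

/-- Parseval's identity for the cosine system on `(0,1)`, indexed by `ℤ`. -/
lemma hasSum_sq_integral_mul_cos {f : ℝ → ℝ} (hf : IntervalIntegrable f volume 0 1)
    (hf2 : IntervalIntegrable (fun x => f x ^ 2) volume 0 1) :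
    HasSum (fun n : ℤ => (∫ x in (0:ℝ)..1, f x * Real.cos (n * Real.pi * x)) ^ 2)
      (∫ x in (0:ℝ)..1, f x ^ 2) := by
  have h : Set.EqOn (fun x => f |x|) f (Set.uIoc 0 1) := fun x hx => by
    rw [Set.uIoc_of_le zero_le_one] at hx
    simp [abs_of_pos hx.1]
  have key := hasSum_sq_fourier_of_parity (F := fun x => f |x|) (s := 1) (by norm_num)
    (fun x => by simp) (hf.congr h.symm) (hf2.congr fun x hx => by simp only [← h hx])
  convert key using 1
  · funext n
    rw [← sq_abs, ← Real.norm_eq_abs, ← Complex.norm_real, ← intervalIntegral.integral_ofReal]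
    congr 2
    refine intervalIntegral.integral_congr_ae (Filter.Eventually.of_forall fun x hx => ?_)
    have := h hx
    simp only at this ⊢
    rw [this]
    push_cast
    rw [Complex.cos]
    ring_nf
  · exact intervalIntegral.integral_congr_ae
      (Filter.Eventually.of_forall fun x hx => by simp only [← h hx])

/-- Parseval's identity for the sine system on `(0,1)`, indexed by `ℤ`. -/
lemma hasSum_sq_integral_mul_sin {f : ℝ → ℝ} (hf : IntervalIntegrable f volume 0 1)
    (hf2 : IntervalIntegrable (fun x => f x ^ 2) volume 0 1) :
    HasSum (fun n : ℤ => (∫ x in (0:ℝ)..1, f x * Real.sin (n * Real.pi * x)) ^ 2)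
      (∫ x in (0:ℝ)..1, f x ^ 2) := by
  have h : Set.EqOn (fun x => x.sign * f |x|) f (Set.uIoc 0 1) := fun x hx => by
    rw [Set.uIoc_of_le zero_le_one] at hx
    simp [abs_of_pos hx.1, Real.sign_of_pos hx.1]
  have key := hasSum_sq_fourier_of_parity (F := fun x => x.sign * f |x|) (s := -1) (by norm_num)
    (fun x => by simp [Real.sign_neg]) (hf.congr h.symm)
    (hf2.congr fun x hx => by simp only [← h hx])
  convert key using 1
  · funext n
    rw [← sq_abs, ← Real.norm_eq_abs, ← Complex.norm_real, ← intervalIntegral.integral_ofReal,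
      show ∀ z : ℂ, ‖z‖ = ‖-Complex.I * z‖ by simp, ← intervalIntegral.integral_const_mul]
    congr 2
    refine intervalIntegral.integral_congr_ae (Filter.Eventually.of_forall fun x hx => ?_)
    have := h hx
    simp only at this ⊢
    rw [this]
    push_cast
    rw [Complex.sin]
    ring_nf
    simp only [Complex.I_sq]
    ring
  · exact intervalIntegral.integral_congr_ae
      (Filter.Eventually.of_forall fun x hx => by simp only [← h hx])

lemma integral_cos_int_mul_pi (n : ℤ) :
    ∫ x in (0:ℝ)..1, Real.cos (n * Real.pi * x) = if n = 0 then 1 else 0 := by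
  split_ifs with hn
  · simp [hn]
  · have : (n * Real.pi : ℝ) ≠ 0 := mul_ne_zero (by exact_mod_cast hn) Real.pi_ne_zero
    rw [intervalIntegral.integral_comp_mul_left _ this]
    simp

lemma integral_cos_mul_cos_int_mul_pi (j n : ℤ) :
    ∫ x in (0:ℝ)..1, Real.cos (j * Real.pi * x) * Real.cos (n * Real.pi * x) =
      ((if j = n then 1 else 0) + (if j = -n then 1 else 0)) / 2 := by
  have h (x : ℝ) : Real.cos (j * Real.pi * x) * Real.cos (n * Real.pi * x) =
      (Real.cos ((j - n : ℤ) * Real.pi * x) + Real.cos ((j + n : ℤ) * Real.pi * x)) / 2 := by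
    push_cast
    rw [sub_mul, sub_mul, add_mul, add_mul, Real.cos_sub, Real.cos_add]
    ring
  simp only [h]
  rw [intervalIntegral.integral_div, intervalIntegral.integral_add
    (Continuous.intervalIntegrable (by fun_prop) _ _)
    (Continuous.intervalIntegrable (by fun_prop) _ _),
    integral_cos_int_mul_pi, integral_cos_int_mul_pi]
  simp only [sub_eq_zero, add_eq_zero_iff_eq_neg]

/-- Integration by parts: the sine coefficients of the weak derivative. -/
lemma IsH1.integral_deriv_mul_sin {u u' : ℝ → ℝ} (hu : IsH1 u u') (n : ℤ) :
    ∫ x in (0:ℝ)..1, u' x * Real.sin (n * Real.pi * x) =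
      -(n * Real.pi * ∫ x in (0:ℝ)..1, u x * Real.cos (n * Real.pi * x)) := by
  obtain ⟨huc, hu', -, huint⟩ := hu
  set U : ℝ → ℝ := fun x => ∫ t in (0:ℝ)..x, u' t
  have hUac : AbsolutelyContinuousOnInterval U 0 1 :=
    hu'.absolutelyContinuousOnInterval_intervalIntegral (by simp)
  have hsac : AbsolutelyContinuousOnInterval (fun x => Real.sin (n * Real.pi * x)) 0 1 :=
    ContDiffOn.absolutelyContinuousOnInterval (ContDiff.contDiffOn (by fun_prop))
  have hderiv (x : ℝ) : deriv (fun x => Real.sin (n * Real.pi * x)) x =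
      n * Real.pi * Real.cos (n * Real.pi * x) := by
    simp [mul_comm]
  have hparts := hUac.integral_mul_deriv_eq_deriv_mul hsac
  have hleft : ∫ x in (0:ℝ)..1, deriv U x * Real.sin (n * Real.pi * x) =
      ∫ x in (0:ℝ)..1, u' x * Real.sin (n * Real.pi * x) := by
    refine intervalIntegral.integral_congr_ae ?_
    filter_upwards [hu'.ae_hasDerivAt_integral] with x hx hx'
    rw [(hx (Set.uIoc_subset_uIcc hx') 0 (by simp)).deriv]
  have hcos : ∫ x in (0:ℝ)..1, n * Real.pi * Real.cos (n * Real.pi * x) = 0 := by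
    rw [intervalIntegral.integral_const_mul, integral_cos_int_mul_pi]
    split_ifs with h <;> simp [h]
  have hright : ∫ x in (0:ℝ)..1, U x * deriv (fun x => Real.sin (n * Real.pi * x)) x =
      n * Real.pi * ∫ x in (0:ℝ)..1, u x * Real.cos (n * Real.pi * x) := by
    have hcongr : ∫ x in (0:ℝ)..1, U x * deriv (fun x => Real.sin (n * Real.pi * x)) x =
        ∫ x in (0:ℝ)..1, (n * Real.pi * (u x * Real.cos (n * Real.pi * x)) -
          u 0 * (n * Real.pi * Real.cos (n * Real.pi * x))) := by
      refine intervalIntegral.integral_congr fun x hx => ?_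
      rw [Set.uIcc_of_le zero_le_one] at hx
      simp only [hderiv, huint x hx]
      ring
    have hui : IntervalIntegrable (fun x => n * Real.pi * (u x * Real.cos (n * Real.pi * x)))
        volume 0 1 := by
      refine ContinuousOn.intervalIntegrable ?_
      rw [Set.uIcc_of_le zero_le_one]
      fun_prop
    rw [hcongr, intervalIntegral.integral_sub hui
      (Continuous.intervalIntegrable (by fun_prop) _ _),
      intervalIntegral.integral_const_mul, intervalIntegral.integral_const_mul (u 0), hcos]
    ring
  rw [hright, hleft] at hparts
  simp only [mul_one, mul_zero, Real.sin_zero, Real.sin_int_mul_pi] at hparts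
  linarith

lemma cosCoeff_of_two_le (u : ℝ → ℝ) {k : ℕ} (hk : 2 ≤ k) :
    cosCoeff u k =
      √2 * ∫ x in (0:ℝ)..1, u x * Real.cos (((k - 1 : ℤ) : ℝ) * Real.pi * x) := by
  rw [cosCoeff, if_neg (by omega), ← intervalIntegral.integral_const_mul]
  push_cast
  congr 1
  funext x
  ring

/-- The cosine coefficients of the remainder are those of `u`, with the first `m` removed. -/
lemma integral_cos_remainder_mul_cos {u : ℝ → ℝ} (hu : ContinuousOn u (Set.Icc 0 1))
    {m : ℕ} (hm : 1 ≤ m) (n : ℤ) :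
    ∫ x in (0:ℝ)..1, (u x - cosCoeff u 1 - ∑ k ∈ Finset.Icc 2 m,
        cosCoeff u k * (√2 * Real.cos (((k:ℝ) - 1) * Real.pi * x))) * Real.cos (n * Real.pi * x) =
      if n.natAbs < m then 0 else ∫ x in (0:ℝ)..1, u x * Real.cos (n * Real.pi * x) := by
  have hui : IntervalIntegrable (fun x => u x * Real.cos (n * Real.pi * x)) volume 0 1 := by
    refine ContinuousOn.intervalIntegrable ?_
    rw [Set.uIcc_of_le zero_le_one]
    fun_prop
  have hterm (k : ℕ) (hk : k ∈ Finset.Icc 2 m) : ∫ x in (0:ℝ)..1, cosCoeff u k *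
      (√2 * Real.cos (((k:ℝ) - 1) * Real.pi * x)) * Real.cos (n * Real.pi * x) =
      if k = n.natAbs + 1 then ∫ x in (0:ℝ)..1, u x * Real.cos (n * Real.pi * x) else 0 := by
    have hk2 := (Finset.mem_Icc.1 hk).1
    have h1 : ∫ x in (0:ℝ)..1, cosCoeff u k *
        (√2 * Real.cos (((k:ℝ) - 1) * Real.pi * x)) * Real.cos (n * Real.pi * x) =
        cosCoeff u k * √2 * ∫ x in (0:ℝ)..1,
          Real.cos (((k - 1 : ℤ) : ℝ) * Real.pi * x) * Real.cos (n * Real.pi * x) := by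
      rw [← intervalIntegral.integral_const_mul]
      push_cast
      congr 1
      funext x
      ring
    have hsq : √2 * √2 = (2:ℝ) := Real.mul_self_sqrt (by norm_num)
    rw [h1, integral_cos_mul_cos_int_mul_pi, cosCoeff_of_two_le u hk2]
    by_cases hp : (k - 1 : ℤ) = n
    · rw [if_pos hp, if_neg (by omega), if_pos (by omega), hp]
      linear_combination (∫ x in (0:ℝ)..1, u x * Real.cos (n * Real.pi * x)) / 2 * hsq
    · by_cases hq : (k - 1 : ℤ) = -n
      · rw [if_neg hp, if_pos hq, if_pos (by omega), hq]
        simp only [Int.cast_neg, neg_mul, Real.cos_neg]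
        linear_combination (∫ x in (0:ℝ)..1, u x * Real.cos (n * Real.pi * x)) / 2 * hsq
      · rw [if_neg hp, if_neg hq, if_neg (by omega)]
        simp
  simp only [sub_mul, Finset.sum_mul]
  simp only [← sub_mul]
  rw [intervalIntegral.integral_sub _ (Continuous.intervalIntegrable (by fun_prop) _ _)]
  · simp only [sub_mul]
    rw [intervalIntegral.integral_sub hui (Continuous.intervalIntegrable (by fun_prop) _ _),
      intervalIntegral.integral_finsetSum
        (fun k _ => Continuous.intervalIntegrable (by fun_prop) _ _),
      intervalIntegral.integral_const_mul, integral_cos_int_mul_pi]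
    simp only [sub_mul] at hterm
    rw [Finset.sum_congr rfl hterm, Finset.sum_ite_eq']
    rcases eq_or_ne n 0 with rfl | hn
    · have : 0 < m := by omega
      simp [cosCoeff, this]
    · by_cases hnm : n.natAbs < m
      · rw [if_neg hn, if_pos (Finset.mem_Icc.2 ⟨by omega, by omega⟩), if_pos hnm]
        ring
      · rw [if_neg hn, if_neg (by rw [Finset.mem_Icc]; omega), if_neg hnm]
        ring
  · refine ContinuousOn.intervalIntegrable ?_
    rw [Set.uIcc_of_le zero_le_one]
    fun_prop

theorem cos_tail_estimate (u u' : ℝ → ℝ) (hu : IsH1 u u') (m : ℕ) (hm : 1 ≤ m) :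
    L2norm (fun x => u x - cosCoeff u 1 - ∑ k ∈ Finset.Icc 2 m,
        cosCoeff u k * (Real.sqrt 2 * Real.cos (((k:ℝ) - 1) * Real.pi * x))) ≤
      (1 / (Real.pi * m)) * L2norm u' := by
  have hcont : ContinuousOn (fun x => u x - cosCoeff u 1 - ∑ k ∈ Finset.Icc 2 m,
      cosCoeff u k * (√2 * Real.cos (((k:ℝ) - 1) * Real.pi * x))) (Set.uIcc 0 1) := by
    have := hu.1
    rw [Set.uIcc_of_le zero_le_one]
    fun_prop
  have hr := hasSum_sq_integral_mul_cos hcont.intervalIntegrable (hcont.pow 2).intervalIntegrable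
  have hd := hasSum_sq_integral_mul_sin hu.2.1 hu.2.2.1
  have hmpos : (0:ℝ) < m := by exact_mod_cast hm
  have hle := hasSum_le (fun n => ?_) (hr.mul_left ((Real.pi * m) ^ 2)) hd
  · unfold L2norm
    rw [one_div, ← div_eq_inv_mul, le_div_iff₀' (by positivity)]
    refine Real.le_sqrt_of_sq_le ?_
    rwa [mul_pow, Real.sq_sqrt
      (intervalIntegral.integral_nonneg zero_le_one fun x _ => sq_nonneg _)]
  · rw [integral_cos_remainder_mul_cos hu.1 hm, hu.integral_deriv_mul_sin]
    split_ifs with hn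
    · simp only [ne_eq, OfNat.ofNat_ne_zero, not_false_eq_true, zero_pow, mul_zero]
      positivity
    · rw [neg_sq, mul_pow _ (∫ x in (0:ℝ)..1, u x * Real.cos (n * Real.pi * x))]
      refine mul_le_mul_of_nonneg_right ?_ (sq_nonneg _)
      rw [mul_comm, mul_pow, mul_pow]
      refine mul_le_mul_of_nonneg_right ?_ (sq_nonneg _)
      rw [← sq_abs (n : ℝ), ← Int.cast_abs, Int.abs_eq_natAbs, Int.cast_natCast]
      have : (m : ℝ) ≤ n.natAbs := by exact_mod_cast not_lt.1 hn
      gcongr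
end

section
/- The map h_cos sending u ∈ H²_N(0,1) to the sequence (ω(1)û_cos(1), ω(2)û_cos(2), …) ∈ ℓ²(ℕ), where ω(k) = √(1 + ((k-1)π)² + ((k-1)π)⁴) and û_cos(k) are the cosine Fourier coefficients of u, is an isometric isomorphism from H²_N(0,1) onto ℓ²(ℕ). -/
open MeasureTheory

/-- `u ∈ H²_N(0,1)`: `u ∈ H²(0,1)` with `u'(0) = u'(1) = 0`, with weak
derivatives `u'` and `u''`. -/
def IsH2N (u u' u'' : ℝ → ℝ) : Prop :=
  IsH1 u u' ∧ IsH1 u' u'' ∧ u' 0 = 0 ∧ u' 1 = 0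

/-- The weights `ω(k) = √(1 + ((k-1)π)² + ((k-1)π)⁴)` (1-based index). -/
noncomputable def omegaW (k : ℕ) : ℝ :=
  Real.sqrt (1 + (((k:ℝ) - 1) * Real.pi) ^ 2 + (((k:ℝ) - 1) * Real.pi) ^ 4)

/-- The map `h_cos(u) = (ω(k) û_cos(k))_{k≥1}` (here reindexed over `k : ℕ`,
`hCos u k = ω(k+1) û_cos(k+1)`). -/
noncomputable def hCos (u : ℝ → ℝ) (k : ℕ) : ℝ :=
  omegaW (k + 1) * cosCoeff u (k + 1)

theorem isH1_primitive {c : ℝ} {g : ℝ → ℝ}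
    (hg : IntervalIntegrable g volume 0 1)
    (hg2 : IntervalIntegrable (fun t => g t ^ 2) volume 0 1) :
    IsH1 (fun x => c + ∫ t in (0:ℝ)..x, g t) g := by
  refine ⟨?_, hg, hg2, fun x _ => by simp⟩
  have := intervalIntegral.continuousOn_primitive_interval' hg (a := 0) (by simp)
  rw [Set.uIcc_of_le zero_le_one] at this
  exact continuousOn_const.add this

theorem isH1_of_hasDerivAt {f f' : ℝ → ℝ} (hf : ∀ x, HasDerivAt f (f' x) x)
    (hf' : Continuous f') : IsH1 f f' := by
  refine ⟨fun x _ => (hf x).continuousAt.continuousWithinAt, hf'.intervalIntegrable _ _,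
    (hf'.pow 2).intervalIntegrable _ _, fun x _ => ?_⟩
  rw [intervalIntegral.integral_eq_sub_of_hasDerivAt (fun y _ => hf y)
    (hf'.intervalIntegrable _ _)]
  ring

/-- An `H¹` function agrees on `[0,1]` with an absolutely continuous function that is almost
everywhere differentiable with the prescribed derivative. -/
theorem IsH1.exists_absolutelyContinuous {u u' : ℝ → ℝ} (hu : IsH1 u u') :
    ∃ U : ℝ → ℝ, AbsolutelyContinuousOnInterval U 0 1 ∧ (∀ x ∈ Set.Icc (0:ℝ) 1, u x = U x) ∧
      ∀ᵐ x, x ∈ Set.Icc (0:ℝ) 1 → HasDerivAt U (u' x) x := by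
  refine ⟨fun x => u 0 + ∫ t in (0:ℝ)..x, u' t, ?_, hu.2.2.2, ?_⟩
  · exact (contDiff_const (c := u 0) (n := 1)).contDiffOn.absolutelyContinuousOnInterval.fun_add
      (hu.2.1.absolutelyContinuousOnInterval_intervalIntegral (c := 0) (by simp))
  · filter_upwards [hu.2.1.ae_hasDerivAt_integral] with x hx hx1
    rw [← Set.uIcc_of_le zero_le_one] at hx1
    exact (hx hx1 0 (by simp)).const_add _

theorem IsH1.integral_deriv_mul_add {u u' v v' : ℝ → ℝ} (hu : IsH1 u u') (hv : IsH1 v v') :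
    (∫ x in (0:ℝ)..1, u' x * v x) + ∫ x in (0:ℝ)..1, u x * v' x = u 1 * v 1 - u 0 * v 0 := by
  obtain ⟨U, hU, huU, hdU⟩ := hu.exists_absolutelyContinuous
  obtain ⟨V, hV, hvV, hdV⟩ := hv.exists_absolutelyContinuous
  rw [huU 1 (by simp), huU 0 (by simp), hvV 1 (by simp), hvV 0 (by simp),
    ← hU.integral_deriv_mul_eq_sub hV, ← intervalIntegral.integral_add]
  · apply intervalIntegral.integral_congr_ae
    filter_upwards [hdU, hdV] with x hx1 hx2 hx
    rw [Set.uIoc_of_le zero_le_one] at hx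
    have hx := Set.Ioc_subset_Icc_self hx
    rw [(hx1 hx).deriv, (hx2 hx).deriv, huU x hx, hvV x hx]
  · exact hu.2.1.mul_continuousOn (by simpa using hv.1)
  · exact hv.2.1.continuousOn_mul (by simpa using hu.1)

/-- The cosine basis `1, √2 cos(πx), √2 cos(2πx), …` of `L²(0,1)`. -/
noncomputable def cosBasis (k : ℕ) (x : ℝ) : ℝ :=
  (if k = 0 then 1 else √2) * Real.cos (k * Real.pi * x)

theorem continuous_cosBasis (k : ℕ) : Continuous (cosBasis k) := by
  unfold cosBasis; fun_prop

theorem cosBasis_zero (x : ℝ) : cosBasis 0 x = 1 := by simp [cosBasis]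

theorem cosCoeff_succ (u : ℝ → ℝ) (k : ℕ) :
    cosCoeff u (k + 1) = ∫ x in (0:ℝ)..1, u x * cosBasis k x := by
  rcases eq_or_ne k 0 with rfl | hk
  · simp [cosCoeff, cosBasis]
  · simp [cosCoeff, cosBasis, hk]

theorem isH2N_cosBasis (k : ℕ) : ∃ c' : ℝ → ℝ,
    IsH2N (cosBasis k) c' (fun x => -(k * Real.pi) ^ 2 * cosBasis k x) := by
  refine ⟨fun x => (if k = 0 then 1 else √2) * (-Real.sin (k * Real.pi * x) * (k * Real.pi)),
    isH1_of_hasDerivAt (fun x => ?_) (by fun_prop),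
    isH1_of_hasDerivAt (fun x => ?_) (continuous_const.mul (continuous_cosBasis k)),
    by simp, by simp⟩
  · have := ((hasDerivAt_id x).const_mul (k * Real.pi)).cos.const_mul
      (if k = 0 then (1:ℝ) else √2)
    simpa only [mul_one, id] using! this
  · have := (((hasDerivAt_id x).const_mul (k * Real.pi)).sin.neg.mul_const
      (k * Real.pi)).const_mul (if k = 0 then (1:ℝ) else √2)
    convert! this using 1
    simp only [cosBasis, id]
    ring

theorem IsH2N.integral_mul_cosBasis {u u' u'' : ℝ → ℝ} (hu : IsH2N u u' u'') (k : ℕ) :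
    ∫ x in (0:ℝ)..1, u'' x * cosBasis k x =
      -(k * Real.pi) ^ 2 * ∫ x in (0:ℝ)..1, u x * cosBasis k x := by
  obtain ⟨hu1, hu2, h0, h1⟩ := hu
  obtain ⟨c', hc1, hc2, hc0, hc1'⟩ := isH2N_cosBasis k
  have e1 := hu2.integral_deriv_mul_add hc1
  have e2 := hu1.integral_deriv_mul_add hc2
  have e3 : ∫ x in (0:ℝ)..1, u x * (-(k * Real.pi) ^ 2 * cosBasis k x) =
      -(k * Real.pi) ^ 2 * ∫ x in (0:ℝ)..1, u x * cosBasis k x := by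
    rw [← intervalIntegral.integral_const_mul]
    congr 1; ext x; ring
  rw [h0, h1] at e1
  rw [hc0, hc1', e3] at e2
  linarith

theorem IsH2N.integral_deriv_sq {u u' u'' : ℝ → ℝ} (hu : IsH2N u u' u'') :
    ∫ x in (0:ℝ)..1, u' x ^ 2 = -∫ x in (0:ℝ)..1, u x * u'' x := by
  have := hu.1.integral_deriv_mul_add hu.2.1
  rw [hu.2.2.1, hu.2.2.2] at this
  simp only [sq]
  linarith

theorem integral_cosBasis_mul_of_ne {j k : ℕ} (hjk : j ≠ k) :
    ∫ x in (0:ℝ)..1, cosBasis j x * cosBasis k x = 0 := by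
  obtain ⟨c', hc⟩ := isH2N_cosBasis j
  have h := hc.integral_mul_cosBasis k
  simp only [mul_assoc, intervalIntegral.integral_const_mul] at h
  have hne : ((j:ℝ) * Real.pi) ^ 2 ≠ (k * Real.pi) ^ 2 := by
    intro h
    have := (pow_left_inj₀ (by positivity) (by positivity) two_ne_zero).1 h
    exact hjk (by exact_mod_cast mul_right_cancel₀ Real.pi_ne_zero this)
  have h2 : (((j:ℝ) * Real.pi) ^ 2 - (k * Real.pi) ^ 2) *
      ∫ x in (0:ℝ)..1, cosBasis j x * cosBasis k x = 0 := by linarith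
  exact (mul_eq_zero.1 h2).resolve_left (sub_ne_zero.2 hne)

theorem integral_cosBasis_mul_self (k : ℕ) :
    ∫ x in (0:ℝ)..1, cosBasis k x * cosBasis k x = 1 := by
  rcases eq_or_ne k 0 with rfl | hk
  · simp [cosBasis]
  have h := integral_cosBasis_mul_of_ne (j := 2 * k) (k := 0) (by omega)
  simp only [cosBasis_zero, mul_one] at h
  have e : ∀ x, cosBasis k x * cosBasis k x = 1 + (√2)⁻¹ * cosBasis (2 * k) x := by
    intro x
    have h2 : √2 * √2 = 2 := Real.mul_self_sqrt (by norm_num)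
    have h3 : Real.cos ((2 * k : ℕ) * Real.pi * x) = 2 * Real.cos (k * Real.pi * x) ^ 2 - 1 := by
      rw [← Real.cos_two_mul]; push_cast; ring_nf
    simp only [cosBasis, hk, h3, if_false, mul_eq_zero, OfNat.ofNat_ne_zero, or_self]
    rw [inv_mul_cancel_left₀ (by positivity)]
    linear_combination (Real.cos (k * Real.pi * x)) ^ 2 * h2
  simp only [e]
  rw [intervalIntegral.integral_add (by simp)
    (((continuous_cosBasis _).const_mul _).intervalIntegrable _ _),
    intervalIntegral.integral_const_mul, h]
  simp

theorem integral_mul_cos_eq_zero {f : ℝ → ℝ}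
    (h : ∀ k, ∫ x in (0:ℝ)..1, f x * cosBasis k x = 0) (k : ℕ) :
    ∫ x in (0:ℝ)..1, f x * Real.cos (k * (Real.pi * x)) = 0 := by
  have h' := h k
  simp only [cosBasis, mul_left_comm (f _), intervalIntegral.integral_const_mul] at h'
  simpa only [mul_assoc] using (mul_eq_zero.1 h').resolve_left (by split_ifs <;> simp)

theorem integral_mul_cos_pow_mul_cos_eq_zero {f : ℝ → ℝ} (hf : IntervalIntegrable f volume 0 1)
    (h : ∀ k, ∫ x in (0:ℝ)..1, f x * cosBasis k x = 0) (n : ℕ) :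
    ∀ k : ℤ, ∫ x in (0:ℝ)..1,
      f x * (Real.cos (Real.pi * x) ^ n * Real.cos (k * (Real.pi * x))) = 0 := by
  induction n with
  | zero =>
    intro k
    obtain ⟨m, rfl | rfl⟩ := k.eq_nat_or_neg
    · simpa using integral_mul_cos_eq_zero h m
    · simpa using integral_mul_cos_eq_zero h m
  | succ n ih =>
    intro k
    have e : ∀ x : ℝ, f x * (Real.cos (Real.pi * x) ^ (n + 1) * Real.cos (k * (Real.pi * x))) =
        2⁻¹ * (f x * (Real.cos (Real.pi * x) ^ n * Real.cos ((k + 1 : ℤ) * (Real.pi * x)))) +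
        2⁻¹ * (f x * (Real.cos (Real.pi * x) ^ n * Real.cos ((k - 1 : ℤ) * (Real.pi * x)))) := by
      intro x
      push_cast
      rw [add_mul, sub_mul, one_mul, Real.cos_add, Real.cos_sub]
      ring
    simp only [e]
    rw [intervalIntegral.integral_add, intervalIntegral.integral_const_mul,
      intervalIntegral.integral_const_mul, ih, ih]
    · simp
    · exact (hf.mul_continuousOn (by fun_prop)).const_mul _
    · exact (hf.mul_continuousOn (by fun_prop)).const_mul _

theorem integral_mul_eval_cos_eq_zero {f : ℝ → ℝ} (hf : IntervalIntegrable f volume 0 1)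
    (h : ∀ k, ∫ x in (0:ℝ)..1, f x * cosBasis k x = 0) (p : Polynomial ℝ) :
    ∫ x in (0:ℝ)..1, f x * p.eval (Real.cos (Real.pi * x)) = 0 := by
  induction p using Polynomial.induction_on' with
  | add p q hp hq =>
    simp only [Polynomial.eval_add, mul_add]
    rw [intervalIntegral.integral_add, hp, hq, add_zero]
    · exact hf.mul_continuousOn (by fun_prop)
    · exact hf.mul_continuousOn (by fun_prop)
  | monomial n a =>
    simp only [Polynomial.eval_monomial, mul_left_comm (f _), intervalIntegral.integral_const_mul]
    simpa using Or.inr (integral_mul_cos_pow_mul_cos_eq_zero hf h n 0)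

theorem integral_mul_eq_zero_of_continuous {f : ℝ → ℝ} (hf : IntervalIntegrable f volume 0 1)
    (h : ∀ k, ∫ x in (0:ℝ)..1, f x * cosBasis k x = 0) {g : ℝ → ℝ} (hg : Continuous g) :
    ∫ x in (0:ℝ)..1, f x * g x = 0 := by
  have hbound : ∀ ε > 0, ‖∫ x in (0:ℝ)..1, f x * g x‖ ≤ ε * ∫ x in (0:ℝ)..1, ‖f x‖ := by
    intro ε hε
    obtain ⟨p, hp⟩ := exists_polynomial_near_of_continuousOn (-1) 1
      (fun y => g (Real.arccos y / Real.pi))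
      (hg.comp (Real.continuous_arccos.div_const _)).continuousOn ε hε
    have e : ∫ x in (0:ℝ)..1, f x * g x =
        ∫ x in (0:ℝ)..1, f x * (g x - p.eval (Real.cos (Real.pi * x))) := by
      simp only [mul_sub]
      rw [intervalIntegral.integral_sub, integral_mul_eval_cos_eq_zero hf h, sub_zero]
      · exact hf.mul_continuousOn hg.continuousOn
      · exact hf.mul_continuousOn (by fun_prop)
    rw [e, ← intervalIntegral.integral_const_mul]
    refine intervalIntegral.norm_integral_le_of_norm_le zero_le_one ?_ (hf.norm.const_mul _)
    refine Filter.Eventually.of_forall fun x hx => ?_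
    have hx' := hp (Real.cos (Real.pi * x)) (Real.cos_mem_Icc _)
    rw [Real.arccos_cos (by have := hx.1; positivity)
      (by nlinarith [hx.2, Real.pi_pos]), mul_div_cancel_left₀ _ Real.pi_ne_zero, abs_sub_comm] at hx'
    rw [norm_mul, mul_comm]
    exact mul_le_mul_of_nonneg_right hx'.le (norm_nonneg _)
  have hlim : Filter.Tendsto (fun ε : ℝ => ε * ∫ x in (0:ℝ)..1, ‖f x‖)
      (nhdsWithin 0 (Set.Ioi 0)) (nhds 0) := by
    have : Continuous fun ε : ℝ => ε * ∫ x in (0:ℝ)..1, ‖f x‖ := by fun_prop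
    simpa using (this.tendsto 0).mono_left nhdsWithin_le_nhds
  exact norm_le_zero_iff.1 (ge_of_tendsto hlim
    (Filter.eventually_of_mem self_mem_nhdsWithin hbound))

/-- An integrable function on `(0,1)` all of whose cosine coefficients vanish is zero. -/
theorem ae_eq_zero_of_integral_mul_cosBasis {f : ℝ → ℝ} (hf : IntervalIntegrable f volume 0 1)
    (h : ∀ k, ∫ x in (0:ℝ)..1, f x * cosBasis k x = 0) :
    f =ᵐ[volume.restrict (Set.Ioc 0 1)] 0 := by
  have hf' := (intervalIntegrable_iff_integrableOn_Ioc_of_le zero_le_one).1 hf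
  have key := IsOpen.ae_eq_zero_of_integral_contDiff_smul_eq_zero (U := Set.Ioo (0:ℝ) 1)
    (f := f) (μ := volume) isOpen_Ioo
    (hf'.mono_set Set.Ioo_subset_Ioc_self).locallyIntegrableOn (fun g hg _ hsupp => ?_)
  · rw [← Measure.restrict_congr_set Ioo_ae_eq_Ioc]
    exact (ae_restrict_iff' measurableSet_Ioo).2 key
  · have := integral_mul_eq_zero_of_continuous hf h hg.continuous
    rw [intervalIntegral.integral_of_le zero_le_one, setIntegral_eq_integral_of_forall_compl_eq_zero]
      at this
    · simpa only [smul_eq_mul, mul_comm] using this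
    · intro x hx
      rw [image_eq_zero_of_notMem_tsupport
        fun hx' => hx (Set.Ioo_subset_Ioc_self (hsupp hx')), mul_zero]

theorem memLp_cosBasis (k : ℕ) : MemLp (cosBasis k) 2 (volume.restrict (Set.Ioc (0:ℝ) 1)) :=
  (memLp_two_iff_integrable_sq (continuous_cosBasis k).aestronglyMeasurable).2
    ((intervalIntegrable_iff_integrableOn_Ioc_of_le zero_le_one).1
      (((continuous_cosBasis k).pow 2).intervalIntegrable 0 1))

theorem inner_toLp_toLp {f g : ℝ → ℝ} (hf : MemLp f 2 (volume.restrict (Set.Ioc (0:ℝ) 1)))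
    (hg : MemLp g 2 (volume.restrict (Set.Ioc (0:ℝ) 1))) :
    inner ℝ (hf.toLp f) (hg.toLp g) = ∫ x in (0:ℝ)..1, f x * g x := by
  rw [L2.inner_def, intervalIntegral.integral_of_le zero_le_one]
  apply integral_congr_ae
  filter_upwards [hf.coeFn_toLp, hg.coeFn_toLp] with x h1 h2
  rw [h1, h2, real_inner_eq_re_inner]
  simp [mul_comm]

theorem orthonormal_cosBasis : Orthonormal ℝ fun k => (memLp_cosBasis k).toLp := by
  rw [orthonormal_iff_ite]
  intro j k
  rw [inner_toLp_toLp]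
  split_ifs with hjk
  · rw [hjk, integral_cosBasis_mul_self]
  · exact integral_cosBasis_mul_of_ne hjk

theorem intervalIntegrable_of_memLp_two {f : ℝ → ℝ}
    (hf : MemLp f 2 (volume.restrict (Set.Ioc (0:ℝ) 1))) : IntervalIntegrable f volume 0 1 :=
  (intervalIntegrable_iff_integrableOn_Ioc_of_le zero_le_one).2 (hf.integrable one_le_two)

theorem span_cosBasis_orthogonal_eq_bot :
    (Submodule.span ℝ (Set.range fun k => (memLp_cosBasis k).toLp))ᗮ = ⊥ := by
  rw [Submodule.eq_bot_iff]
  intro f hf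
  have hfm := Lp.memLp f
  rw [Lp.eq_zero_iff_ae_eq_zero]
  refine ae_eq_zero_of_integral_mul_cosBasis (intervalIntegrable_of_memLp_two hfm) fun k => ?_
  rw [← inner_toLp_toLp hfm (memLp_cosBasis k), Lp.toLp_coeFn]
  exact Submodule.inner_left_of_mem_orthogonal (Submodule.subset_span (Set.mem_range_self k)) hf

/-- The cosine functions form a Hilbert basis of `L²(0,1)`. -/
noncomputable def cosHilbertBasis :
    HilbertBasis ℕ ℝ (Lp ℝ 2 (volume.restrict (Set.Ioc (0:ℝ) 1))) :=
  HilbertBasis.mkOfOrthogonalEqBot orthonormal_cosBasis span_cosBasis_orthogonal_eq_bot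

theorem cosHilbertBasis_apply (k : ℕ) : cosHilbertBasis k = (memLp_cosBasis k).toLp := by
  simp [cosHilbertBasis]

/-- Parseval's identity for the cosine basis. -/
theorem hasSum_integral_mul_cosBasis {f g : ℝ → ℝ}
    (hf : MemLp f 2 (volume.restrict (Set.Ioc (0:ℝ) 1)))
    (hg : MemLp g 2 (volume.restrict (Set.Ioc (0:ℝ) 1))) :
    HasSum (fun k => (∫ x in (0:ℝ)..1, f x * cosBasis k x) * ∫ x in (0:ℝ)..1, g x * cosBasis k x)
      (∫ x in (0:ℝ)..1, f x * g x) := by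
  have := cosHilbertBasis.hasSum_inner_mul_inner (hf.toLp f) (hg.toLp g)
  simpa only [cosHilbertBasis_apply, inner_toLp_toLp, mul_comm (cosBasis _ _) (g _)] using this

/-- The Riesz–Fischer theorem for the cosine basis. -/
theorem exists_memLp_integral_mul_cosBasis_eq {a : ℕ → ℝ} (ha : Summable fun k => a k ^ 2) :
    ∃ f : ℝ → ℝ, MemLp f 2 (volume.restrict (Set.Ioc (0:ℝ) 1)) ∧
      ∀ k, ∫ x in (0:ℝ)..1, f x * cosBasis k x = a k := by
  have hmem : Memℓp a 2 := memℓp_gen (by simpa using ha)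
  let F := cosHilbertBasis.repr.symm ⟨a, hmem⟩
  refine ⟨F, Lp.memLp F, fun k => ?_⟩
  rw [← inner_toLp_toLp (Lp.memLp F) (memLp_cosBasis k), Lp.toLp_coeFn, ← cosHilbertBasis_apply,
    real_inner_comm, ← HilbertBasis.repr_apply_apply]
  simp [F]

theorem IsH1.memLp {u u' : ℝ → ℝ} (hu : IsH1 u u') :
    MemLp u 2 (volume.restrict (Set.Ioc (0:ℝ) 1)) ∧
      MemLp u' 2 (volume.restrict (Set.Ioc (0:ℝ) 1)) := by
  obtain ⟨hc, hi, hi2, -⟩ := hu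
  rw [intervalIntegrable_iff_integrableOn_Ioc_of_le zero_le_one] at hi hi2
  exact ⟨(memLp_two_iff_integrable_sq
      ((hc.mono Set.Ioc_subset_Icc_self).aestronglyMeasurable measurableSet_Ioc)).2
        ((hc.pow 2).integrableOn_Icc.mono_set Set.Ioc_subset_Icc_self),
    (memLp_two_iff_integrable_sq hi.aestronglyMeasurable).2 hi2⟩

theorem omegaW_succ (k : ℕ) :
    omegaW (k + 1) = √(1 + (k * Real.pi) ^ 2 + (k * Real.pi) ^ 4) := by
  simp [omegaW]

theorem omegaW_succ_sq (k : ℕ) :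
    omegaW (k + 1) ^ 2 = 1 + (k * Real.pi) ^ 2 + (k * Real.pi) ^ 4 := by
  rw [omegaW_succ, Real.sq_sqrt (by positivity)]

theorem omegaW_succ_ne_zero (k : ℕ) : omegaW (k + 1) ≠ 0 := by
  rw [omegaW_succ]; positivity

theorem IsH2N.hasSum_hCos_sq {u u' u'' : ℝ → ℝ} (hu : IsH2N u u' u'') :
    HasSum (fun k => hCos u k ^ 2)
      ((∫ x in (0:ℝ)..1, u x ^ 2) + (∫ x in (0:ℝ)..1, u' x ^ 2) +
        ∫ x in (0:ℝ)..1, u'' x ^ 2) := by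
  have m0 := hu.1.memLp.1
  have m2 := hu.2.1.memLp.2
  have h := ((hasSum_integral_mul_cosBasis m0 m0).add
    (hasSum_integral_mul_cosBasis m0 m2).neg).add (hasSum_integral_mul_cosBasis m2 m2)
  rw [← hu.integral_deriv_sq] at h
  simp only [hu.integral_mul_cosBasis, ← sq] at h
  convert! h using 2 with k
  rw [hCos, cosCoeff_succ, mul_pow, omegaW_succ_sq]
  ring

theorem eqOn_of_hCos_eq {u v : ℝ → ℝ} (hu : ContinuousOn u (Set.Icc 0 1))
    (hv : ContinuousOn v (Set.Icc 0 1)) (h : ∀ k, hCos u k = hCos v k) :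
    Set.EqOn u v (Set.Icc 0 1) := by
  have hui := hu.intervalIntegrable_of_Icc (μ := volume) zero_le_one
  have hvi := hv.intervalIntegrable_of_Icc (μ := volume) zero_le_one
  refine Measure.eqOn_Icc_of_ae_eq volume zero_ne_one ?_ hu hv
  rw [← Measure.restrict_congr_set Ioc_ae_eq_Icc, ← sub_ae_eq_zero]
  refine ae_eq_zero_of_integral_mul_cosBasis (hui.sub hvi) fun k => ?_
  have hk := mul_left_cancel₀ (omegaW_succ_ne_zero k) (h k)
  rw [cosCoeff_succ, cosCoeff_succ] at hk
  simp only [Pi.sub_apply, sub_mul]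
  rw [intervalIntegral.integral_sub
    (hui.mul_continuousOn (continuous_cosBasis k).continuousOn)
    (hvi.mul_continuousOn (continuous_cosBasis k).continuousOn), hk, sub_self]

theorem exists_isH2N_hCos_eq {a : ℕ → ℝ} (ha : Summable fun k => a k ^ 2) :
    ∃ u u' u'' : ℝ → ℝ, IsH2N u u' u'' ∧ ∀ k, hCos u k = a k := by
  have hb : Summable fun k : ℕ => (-(k * Real.pi) ^ 2 * (a k / omegaW (k + 1))) ^ 2 := by
    refine Summable.of_nonneg_of_le (fun k => sq_nonneg _) (fun k => ?_) ha
    rw [mul_pow, div_pow, omegaW_succ_sq, mul_div_assoc', div_le_iff₀ (by positivity)]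
    nlinarith [mul_nonneg (sq_nonneg (a k)) (sq_nonneg (k * Real.pi)), sq_nonneg (a k)]
  obtain ⟨u'', hm, hcoef⟩ := exists_memLp_integral_mul_cosBasis_eq hb
  have hi := intervalIntegrable_of_memLp_two hm
  have hi2 : IntervalIntegrable (fun t => u'' t ^ 2) volume 0 1 :=
    (intervalIntegrable_iff_integrableOn_Ioc_of_le zero_le_one).2 hm.integrable_sq
  have h1 := isH1_primitive (c := 0) hi hi2
  set u' : ℝ → ℝ := fun x => 0 + ∫ t in (0:ℝ)..x, u'' t with hu'
  have hw := isH1_primitive (c := 0) (h1.1.intervalIntegrable_of_Icc zero_le_one)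
    ((h1.1.pow 2).intervalIntegrable_of_Icc zero_le_one)
  set w : ℝ → ℝ := fun x => 0 + ∫ t in (0:ℝ)..x, u' t
  have hu := isH1_primitive (c := a 0 - ∫ x in (0:ℝ)..1, w x)
    (h1.1.intervalIntegrable_of_Icc zero_le_one)
    ((h1.1.pow 2).intervalIntegrable_of_Icc zero_le_one)
  set u : ℝ → ℝ := fun x => (a 0 - ∫ x in (0:ℝ)..1, w x) + ∫ t in (0:ℝ)..x, u' t with hudef
  have hH : IsH2N u u' u'' := by
    refine ⟨hu, h1, by simp [hu'], ?_⟩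
    have := hcoef 0
    simp only [cosBasis_zero, mul_one] at this
    simp [hu', this]
  refine ⟨u, u', u'', hH, fun k => ?_⟩
  rw [hCos, cosCoeff_succ]
  rcases eq_or_ne k 0 with rfl | hk
  · have huw : ∀ x, u x = (a 0 - ∫ x in (0:ℝ)..1, w x) + w x := by simp [hudef, w]
    simp only [cosBasis_zero, mul_one, huw]
    rw [intervalIntegral.integral_add (by simp) (hw.1.intervalIntegrable_of_Icc zero_le_one)]
    simp [omegaW]
  · have := hcoef k
    rw [hH.integral_mul_cosBasis] at this
    rw [mul_left_cancel₀ (neg_ne_zero.2 (by positivity)) this,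
      mul_div_cancel₀ _ (omegaW_succ_ne_zero k)]

/-- `h_cos : H²_N(0,1) → ℓ²(ℕ)` is an isometric isomorphism: for every `u ∈ H²_N`
the sequence `h_cos(u)` is square-summable with `‖h_cos(u)‖²_{ℓ²} = ‖u‖²_{H²}`
(isometry; by linearity of `h_cos` this also gives injectivity, recorded here on
continuous representatives), and every square-summable sequence is attained
(surjectivity). -/
theorem hCos_isometric_isomorphism :
    (∀ u u' u'' : ℝ → ℝ, IsH2N u u' u'' →
      Summable (fun k => hCos u k ^ 2) ∧
      ∑' k : ℕ, hCos u k ^ 2 =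
        (∫ x in (0:ℝ)..1, u x ^ 2) + (∫ x in (0:ℝ)..1, u' x ^ 2) +
          ∫ x in (0:ℝ)..1, u'' x ^ 2) ∧
    (∀ u u' u'' v v' v'' : ℝ → ℝ, IsH2N u u' u'' → IsH2N v v' v'' →
      (∀ k, hCos u k = hCos v k) → ∀ x ∈ Set.Icc (0:ℝ) 1, u x = v x) ∧
    (∀ a : ℕ → ℝ, Summable (fun k => a k ^ 2) →
      ∃ u u' u'' : ℝ → ℝ, IsH2N u u' u'' ∧ ∀ k, hCos u k = a k) := by
  exact ⟨fun u u' u'' hu => ⟨hu.hasSum_hCos_sq.summable, hu.hasSum_hCos_sq.tsum_eq⟩,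
    fun u u' u'' v v' v'' hu hv h => eqOn_of_hCos_eq hu.1.1 hv.1.1 h,
    fun a ha => exists_isH2N_hCos_eq ha⟩
end
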